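/- Let A ∈ ℝ^{2n×2n} be symmetric positive definite and β > 0. If X ∈ ℝ^{2n×2p} is a first-order stationary point of f_β (AX − βJ_nX(XᵀJ_nX − J_p) = 0), then the matrix W := −XᵀJ_nX·J_p satisfies W = (1/β)XᵀAX + WWᵀ; in particular XᵀAX = β(W − W²) with W symmetric. -/

import Mathlib

open Matrix BigOperators

noncomputable section

/-- The Poisson matrix `J_k = [[0, I],[-I, 0]]`, on index type `Fin k ⊕ Fin k`
(representing dimension `2k`). -/
def Jmat (k : ℕ) : Matrix (Fin k ⊕ Fin k) (Fin k ⊕ Fin k) ℝ :=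
  Matrix.fromBlocks 0 1 (-1) 0

/-- Squared Frobenius norm `‖M‖_F² = tr(Mᵀ M)`. -/
def frobSq {m k : Type*} [Fintype m] [Fintype k] (M : Matrix m k ℝ) : ℝ :=
  Matrix.trace (Mᵀ * M)

/-- The Frobenius norm. -/
def frobNorm {m k : Type*} [Fintype m] [Fintype k] (M : Matrix m k ℝ) : ℝ :=
  Real.sqrt (frobSq M)

/-- The trace-penalty function `f_β`. -/
def fPen (n p : ℕ) (A : Matrix (Fin n ⊕ Fin n) (Fin n ⊕ Fin n) ℝ) (β : ℝ)
    (X : Matrix (Fin n ⊕ Fin n) (Fin p ⊕ Fin p) ℝ) : ℝ :=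
  (1 / 2) * Matrix.trace (Xᵀ * A * X) + (β / 4) * frobSq (Xᵀ * Jmat n * X - Jmat p)

/-- The gradient `∇f_β(X) = AX - βJ_nX(XᵀJ_nX - J_p)`. -/
def gradPen (n p : ℕ) (A : Matrix (Fin n ⊕ Fin n) (Fin n ⊕ Fin n) ℝ) (β : ℝ)
    (X : Matrix (Fin n ⊕ Fin n) (Fin p ⊕ Fin p) ℝ) :
    Matrix (Fin n ⊕ Fin n) (Fin p ⊕ Fin p) ℝ :=
  A * X - β • (Jmat n * X * (Xᵀ * Jmat n * X - Jmat p))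

theorem Jmat_transpose (k : ℕ) : (Jmat k)ᵀ = -Jmat k := by
  simp [Jmat, Matrix.fromBlocks_transpose, Matrix.fromBlocks_neg]

theorem Jmat_mul_self (k : ℕ) : Jmat k * Jmat k = -1 := by
  simp [Jmat, Matrix.fromBlocks_multiply, ← Matrix.fromBlocks_one, Matrix.fromBlocks_neg]

theorem stmt17 (n p : ℕ)
    (A : Matrix (Fin n ⊕ Fin n) (Fin n ⊕ Fin n) ℝ) (hA : A.PosDef)
    (β : ℝ) (hβ : 0 < β)
    (X : Matrix (Fin n ⊕ Fin n) (Fin p ⊕ Fin p) ℝ)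
    (hstat : gradPen n p A β X = 0) :
    (-(Xᵀ * Jmat n * X * Jmat p)) =
        (1 / β) • (Xᵀ * A * X) +
          (-(Xᵀ * Jmat n * X * Jmat p)) * (-(Xᵀ * Jmat n * X * Jmat p))ᵀ ∧
    Xᵀ * A * X =
        β • ((-(Xᵀ * Jmat n * X * Jmat p)) -
          (-(Xᵀ * Jmat n * X * Jmat p)) * (-(Xᵀ * Jmat n * X * Jmat p))) ∧
    (-(Xᵀ * Jmat n * X * Jmat p))ᵀ = -(Xᵀ * Jmat n * X * Jmat p) := by
  have hS : (Xᵀ * Jmat n * X)ᵀ = -(Xᵀ * Jmat n * X) := by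
    simp [Matrix.transpose_mul, Jmat_transpose, Matrix.mul_assoc]
  have hAT : Aᵀ = A := by
    simpa [Matrix.IsHermitian, Matrix.conjTranspose_eq_transpose_of_trivial] using hA.isHermitian
  have hGT : (Xᵀ * A * X)ᵀ = Xᵀ * A * X := by
    simp [Matrix.transpose_mul, hAT, Matrix.mul_assoc]
  have hG : Xᵀ * A * X =
      β • (Xᵀ * Jmat n * X * (Xᵀ * Jmat n * X - Jmat p)) := by
    have h : A * X = β • (Jmat n * X * (Xᵀ * Jmat n * X - Jmat p)) := sub_eq_zero.mp hstat
    rw [Matrix.mul_assoc, h, Matrix.mul_smul]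
    simp only [Matrix.mul_assoc]
  generalize Xᵀ * Jmat n * X = S at *
  generalize Xᵀ * A * X = G at *
  have hWWT : -(S * Jmat p) * (-(S * Jmat p))ᵀ = -(S * S) := by
    rw [Matrix.transpose_neg, Matrix.transpose_mul, hS, Jmat_transpose, neg_mul_neg, neg_mul_neg,
      Matrix.mul_assoc, ← Matrix.mul_assoc (Jmat p), Jmat_mul_self, neg_one_mul, mul_neg]
  have hdiv : (1 / β) • G = S * S - S * Jmat p := by
    rw [hG, smul_smul, one_div_mul_cancel hβ.ne', one_smul, mul_sub]
  have hW : -(S * Jmat p) = (1 / β) • G + -(S * Jmat p) * (-(S * Jmat p))ᵀ := by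
    rw [hWWT, hdiv]
    abel
  have hWT : (-(S * Jmat p))ᵀ = -(S * Jmat p) := by
    rw [hW, Matrix.transpose_add, Matrix.transpose_smul, hGT, Matrix.transpose_mul,
      Matrix.transpose_transpose]
  refine ⟨hW, ?_, hWT⟩
  rw [hWT] at hWWT
  rw [hWWT, hG, mul_sub]
  congr 1
  abel
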